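/- arXiv:1212.6957 — 4 statements merged into one kernel-verified Lean document; each statement's English description precedes it below -/
import Mathlib

section
/- Let N be a positive integer and let E₀, E₁, E₂ be N×N real matrices with E₀ invertible and E₀, E₂ symmetric. Let Z be the 2N×2N block matrix Z = [[E₀⁻¹E₁ᵀ, −E₀⁻¹], [−E₂ + E₁E₀⁻¹E₁ᵀ, −E₁E₀⁻¹]]. Then for every λ ∈ ℝ, det(Z − λ·I_{2N}) = det(Z + λ·I_{2N}); consequently λ is an eigenvalue of Z if and only if −λ is an eigenvalue of Z, so the eigenvalues of Z occur in pairs (λ, −λ). -/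
open Matrix in
/-- A Hamiltonian block matrix is skew-adjoint for the symplectic form `J`. -/
theorem J_mul_fromBlocks_hamiltonian {l R : Type*} [Fintype l] [DecidableEq l] [CommRing R]
    (A B C : Matrix l l R) (hB : Bᵀ = B) (hC : Cᵀ = C) :
    J l R * fromBlocks A B C (-Aᵀ) = -((fromBlocks A B C (-Aᵀ))ᵀ * J l R) := by
  simp [J, fromBlocks_transpose, fromBlocks_multiply, fromBlocks_neg, hB, hC]

open Matrix in
/-- The characteristic determinant of a matrix that is skew-adjoint for `J` is even. -/
theorem det_sub_smul_one_eq_det_add_smul_one {l R : Type*} [Fintype l] [DecidableEq l]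
    [CommRing R] {Z : Matrix (l ⊕ l) (l ⊕ l) R} (h : J l R * Z = -(Zᵀ * J l R)) (c : R) :
    (Z - c • (1 : Matrix (l ⊕ l) (l ⊕ l) R)).det =
      (Z + c • (1 : Matrix (l ⊕ l) (l ⊕ l) R)).det := by
  have key : J l R * (Z - c • 1) = -((Z + c • 1)ᵀ * J l R) := by
    simp only [mul_sub, transpose_add, transpose_smul, transpose_one, add_mul, h,
      Matrix.mul_smul, Matrix.smul_mul, mul_one, one_mul]
    abel
  have hdet := congrArg det key
  rw [det_neg, det_mul, det_mul, det_transpose, Fintype.card_sum,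
    Even.neg_one_pow ⟨_, rfl⟩, one_mul, mul_comm _ (J l R).det] at hdet
  exact (isUnit_det_J l R).mul_left_cancel hdet

open Matrix in
theorem exists_mulVec_eq_smul_iff_det_sub_eq_zero {n K : Type*} [Fintype n] [DecidableEq n]
    [Field K] (M : Matrix n n K) (c : K) :
    (∃ v : n → K, v ≠ 0 ∧ M.mulVec v = c • v) ↔ (M - c • (1 : Matrix n n K)).det = 0 := by
  rw [← exists_mulVec_eq_zero_iff]
  simp only [sub_mulVec, smul_mulVec, one_mulVec, sub_eq_zero]


/-- with `E₀` invertible and `E₀, E₂` symmetric, the characteristic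
determinant of the SBFEM linearization matrix `Z` is even in `λ`:
`det(Z − λI) = det(Z + λI)`; consequently `λ` is an eigenvalue of `Z` iff `−λ`
is, so eigenvalues of `Z` occur in pairs `(λ, −λ)`. -/
theorem sbfem_Z_eigenvalues_in_pairs
    (N : ℕ) (hN : 0 < N) (E₀ E₁ E₂ : Matrix (Fin N) (Fin N) ℝ)
    (hE₀ : IsUnit E₀.det) (hE₀sym : E₀.transpose = E₀) (hE₂sym : E₂.transpose = E₂) :
    let Z : Matrix (Fin N ⊕ Fin N) (Fin N ⊕ Fin N) ℝ :=
      Matrix.fromBlocks (E₀⁻¹ * E₁.transpose) (-E₀⁻¹)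
        (-E₂ + E₁ * E₀⁻¹ * E₁.transpose) (-(E₁ * E₀⁻¹))
    ((∀ lam : ℝ, (Z - lam • (1 : Matrix (Fin N ⊕ Fin N) (Fin N ⊕ Fin N) ℝ)).det
        = (Z + lam • (1 : Matrix (Fin N ⊕ Fin N) (Fin N ⊕ Fin N) ℝ)).det) ∧
      (∀ lam : ℝ,
        (∃ v : Fin N ⊕ Fin N → ℝ, v ≠ 0 ∧ Z.mulVec v = lam • v) ↔
        (∃ v : Fin N ⊕ Fin N → ℝ, v ≠ 0 ∧ Z.mulVec v = (-lam) • v))) := by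
  intro Z
  have hE₀inv : (E₀⁻¹).transpose = E₀⁻¹ := by rw [Matrix.transpose_nonsing_inv, hE₀sym]
  have hJ : Matrix.J (Fin N) ℝ * Z = -(Z.transpose * Matrix.J (Fin N) ℝ) := by
    have hA : E₁ * E₀⁻¹ = (E₀⁻¹ * E₁.transpose).transpose := by
      rw [Matrix.transpose_mul, Matrix.transpose_transpose, hE₀inv]
    have hZ : Z = Matrix.fromBlocks (E₀⁻¹ * E₁.transpose) (-E₀⁻¹)
        (-E₂ + E₁ * E₀⁻¹ * E₁.transpose) (-(E₀⁻¹ * E₁.transpose).transpose) := by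
      rw [← hA]
    rw [hZ]
    apply J_mul_fromBlocks_hamiltonian
    · rw [Matrix.transpose_neg, hE₀inv]
    · simp only [Matrix.transpose_add, Matrix.transpose_neg, Matrix.transpose_mul,
        Matrix.transpose_transpose, hE₀inv, hE₂sym, mul_assoc]
  have hdet := det_sub_smul_one_eq_det_add_smul_one hJ
  refine ⟨hdet, fun lam => ?_⟩
  rw [exists_mulVec_eq_smul_iff_det_sub_eq_zero, exists_mulVec_eq_smul_iff_det_sub_eq_zero,
    hdet, neg_smul, sub_neg_eq_add]
end

section
/- For a 2-node line element with nodal coordinates (x₁,y₁), (x₂,y₂) satisfying a = x₁y₂ − x₂y₁ ≠ 0, with shape functions N₁(η) = (1−η)/2, N₂(η) = (1+η)/2, boundary geometry x_b(η) = N₁x₁ + N₂x₂, y_b(η) = N₁y₁ + N₂y₂, Jacobian det J(η) = x_b y_b' − y_b x_b', strain matrix B₁(η) = b₁(η)·[N₁(η)I₂, N₂(η)I₂] where b₁(η) = (1/det J)·[[y_b'(η), 0], [0, −x_b'(η)], [−x_b'(η), y_b'(η)]], and D a 3×3 real matrix, the coefficient matrix E₀ = ∫_{−1}^{1} B₁(η)ᵀ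 D B₁(η) det J(η) dη equals the 4×4 block matrix (2/3)·[[2Q⁰, Q⁰], [Q⁰, 2Q⁰]], where Q⁰ = (1/(4a))·C₁ᵀ D C₁ and C₁ = [[y₂−y₁, 0], [0, −(x₂−x₁)], [−(x₂−x₁), y₂−y₁]]. -/
namespace SBFEMStmt10

/-- linear shape function `N₁(η) = (1−η)/2` -/
noncomputable def N1 (η : ℝ) : ℝ := (1 - η) / 2
/-- linear shape function `N₂(η) = (1+η)/2` -/
noncomputable def N2 (η : ℝ) : ℝ := (1 + η) / 2
/-- boundary geometry `x_b(η) = N₁(η)x₁ + N₂(η)x₂` -/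
noncomputable def xb (x₁ x₂ η : ℝ) : ℝ := N1 η * x₁ + N2 η * x₂
/-- boundary geometry `y_b(η) = N₁(η)y₁ + N₂(η)y₂` -/
noncomputable def yb (y₁ y₂ η : ℝ) : ℝ := N1 η * y₁ + N2 η * y₂
/-- Jacobian determinant `det J(η) = x_b y_b' − y_b x_b'` -/
noncomputable def detJ (x₁ y₁ x₂ y₂ η : ℝ) : ℝ :=
  xb x₁ x₂ η * deriv (yb y₁ y₂) η - yb y₁ y₂ η * deriv (xb x₁ x₂) η
/-- `b₁(η) = (1/det J)·[[y_b', 0], [0, −x_b'], [−x_b', y_b']]` -/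
noncomputable def b1 (x₁ y₁ x₂ y₂ η : ℝ) : Matrix (Fin 3) (Fin 2) ℝ :=
  (1 / detJ x₁ y₁ x₂ y₂ η) •
    !![deriv (yb y₁ y₂) η, 0;
       0, -(deriv (xb x₁ x₂) η);
       -(deriv (xb x₁ x₂) η), deriv (yb y₁ y₂) η]
/-- shape function matrix `[N₁ I₂, N₂ I₂]` -/
noncomputable def Nmat (η : ℝ) : Matrix (Fin 2) (Fin 4) ℝ :=
  !![N1 η, 0, N2 η, 0;
     0, N1 η, 0, N2 η]
/-- strain matrix `B₁(η) = b₁(η)·[N₁ I₂, N₂ I₂]` -/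
noncomputable def B1 (x₁ y₁ x₂ y₂ η : ℝ) : Matrix (Fin 3) (Fin 4) ℝ :=
  b1 x₁ y₁ x₂ y₂ η * Nmat η
/-- `C₁ = [[y₂−y₁, 0], [0, −(x₂−x₁)], [−(x₂−x₁), y₂−y₁]]` -/
noncomputable def C1 (x₁ y₁ x₂ y₂ : ℝ) : Matrix (Fin 3) (Fin 2) ℝ :=
  !![y₂ - y₁, 0;
     0, -(x₂ - x₁);
     -(x₂ - x₁), y₂ - y₁]
/-- `Q⁰ = (1/(4a))·C₁ᵀ D C₁` with `a = x₁y₂ − x₂y₁` -/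
noncomputable def Q0 (x₁ y₁ x₂ y₂ : ℝ) (D : Matrix (Fin 3) (Fin 3) ℝ) :
    Matrix (Fin 2) (Fin 2) ℝ :=
  (1 / (4 * (x₁ * y₂ - x₂ * y₁))) •
    ((C1 x₁ y₁ x₂ y₂).transpose * D * C1 x₁ y₁ x₂ y₂)

lemma deriv_linear_interp (u v η : ℝ) : deriv (fun t => N1 t * u + N2 t * v) η = (v - u) / 2 := by
  have h : HasDerivAt (fun t => N1 t * u + N2 t * v) (-1 / 2 * u + 1 / 2 * v) η :=
    ((((hasDerivAt_id η).const_sub 1).div_const 2).mul_const u).add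
      ((((hasDerivAt_id η).const_add 1).div_const 2).mul_const v)
  rw [h.deriv]
  ring

lemma deriv_xb (x₁ x₂ η : ℝ) : deriv (xb x₁ x₂) η = (x₂ - x₁) / 2 :=
  deriv_linear_interp x₁ x₂ η

lemma deriv_yb (y₁ y₂ η : ℝ) : deriv (yb y₁ y₂) η = (y₂ - y₁) / 2 :=
  deriv_linear_interp y₁ y₂ η

lemma detJ_eq (x₁ y₁ x₂ y₂ η : ℝ) :
    detJ x₁ y₁ x₂ y₂ η = (x₁ * y₂ - x₂ * y₁) / 2 := by
  simp only [detJ, deriv_xb, deriv_yb, xb, yb, N1, N2]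
  ring

lemma b1_eq (x₁ y₁ x₂ y₂ η : ℝ) :
    b1 x₁ y₁ x₂ y₂ η = (1 / (x₁ * y₂ - x₂ * y₁)) • C1 x₁ y₁ x₂ y₂ := by
  ext i j
  fin_cases i <;> fin_cases j <;>
    simp [b1, C1, detJ_eq, deriv_xb, deriv_yb] <;> ring

lemma integrand_eq (x₁ y₁ x₂ y₂ : ℝ) (ha : x₁ * y₂ - x₂ * y₁ ≠ 0)
    (D : Matrix (Fin 3) (Fin 3) ℝ) (η : ℝ) (i j : Fin 4) :
    ((B1 x₁ y₁ x₂ y₂ η).transpose * D * B1 x₁ y₁ x₂ y₂ η) i j * detJ x₁ y₁ x₂ y₂ η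
      = 2 * ((Nmat η).transpose * Q0 x₁ y₁ x₂ y₂ D * Nmat η) i j := by
  simp only [B1, b1_eq, detJ_eq, Q0, Matrix.transpose_mul, Matrix.transpose_smul,
    Matrix.smul_mul, Matrix.mul_smul, Matrix.mul_assoc, Matrix.smul_apply, smul_eq_mul]
  field_simp
  ring

lemma integral_affine_mul_affine (a b c d : ℝ) :
    ∫ η in (-1 : ℝ)..1, (a + b * η) * (c + d * η) = 2 * a * c + 2 / 3 * (b * d) := by
  have h (η : ℝ) : HasDerivAt
      (fun t => a * c * t + (a * d + b * c) / 2 * t ^ 2 + b * d / 3 * t ^ 3)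
      ((a + b * η) * (c + d * η)) η := by
    refine ((((hasDerivAt_id' η).const_mul (a * c)).fun_add
      ((hasDerivAt_pow 2 η).const_mul ((a * d + b * c) / 2))).fun_add
      ((hasDerivAt_pow 3 η).const_mul (b * d / 3))).congr_deriv ?_
    push_cast
    ring
  rw [intervalIntegral.integral_eq_sub_of_hasDerivAt (fun η _ => h η)
    (Continuous.intervalIntegrable (by fun_prop) _ _)]
  ring

lemma N1_eq (η : ℝ) : N1 η = 1 / 2 + -1 / 2 * η := by
  simp only [N1]; ring

lemma N2_eq (η : ℝ) : N2 η = 1 / 2 + 1 / 2 * η := by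
  simp only [N2]; ring

lemma Nmat_inl (η : ℝ) (k i : Fin 2) :
    Nmat η k (finSumFinEquiv (m := 2) (n := 2) (Sum.inl i)) = if k = i then N1 η else 0 := by
  fin_cases k <;> fin_cases i <;> rfl

lemma Nmat_inr (η : ℝ) (k i : Fin 2) :
    Nmat η k (finSumFinEquiv (m := 2) (n := 2) (Sum.inr i)) = if k = i then N2 η else 0 := by
  fin_cases k <;> fin_cases i <;> rfl

lemma integral_Nmat (Q : Matrix (Fin 2) (Fin 2) ℝ) (i j : Fin 4) :
    ∫ η in (-1 : ℝ)..1, 2 * ((Nmat η).transpose * Q * Nmat η) i j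
      = (Matrix.reindex finSumFinEquiv finSumFinEquiv
          (((2 : ℝ) / 3) • Matrix.fromBlocks ((2 : ℝ) • Q) Q Q ((2 : ℝ) • Q))
          : Matrix (Fin 4) (Fin 4) ℝ) i j := by
  obtain ⟨i, rfl⟩ := (finSumFinEquiv (m := 2) (n := 2)).surjective i
  obtain ⟨j, rfl⟩ := (finSumFinEquiv (m := 2) (n := 2)).surjective j
  have key (f g : ℝ → ℝ) (c : ℝ) :
      ∫ η in (-1 : ℝ)..1, 2 * (f η * c * g η) = 2 * c * ∫ η in (-1 : ℝ)..1, f η * g η := by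
    rw [← intervalIntegral.integral_const_mul]
    congr 1 with η
    ring
  rcases i with i | i <;> rcases j with j | j <;>
    simp only [Matrix.mul_apply, Matrix.transpose_apply, Nmat_inl, Nmat_inr, ite_mul, mul_ite,
      zero_mul, mul_zero, Finset.sum_ite_eq', Finset.mem_univ, if_true, key,
      Matrix.reindex_apply, Matrix.submatrix_apply, Equiv.symm_apply_apply, Matrix.smul_apply,
      Matrix.fromBlocks_apply₁₁, Matrix.fromBlocks_apply₁₂, Matrix.fromBlocks_apply₂₁,
      Matrix.fromBlocks_apply₂₂, smul_eq_mul, N1_eq, N2_eq, integral_affine_mul_affine] <;>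
    ring

/-- the SBFEM coefficient matrix
`E₀ = ∫_{−1}^{1} B₁ᵀ D B₁ det J dη` for a 2-node line element equals the 4×4
block matrix `(2/3)·[[2Q⁰, Q⁰], [Q⁰, 2Q⁰]]`. -/
theorem sbfem_E0_closed_form (x₁ y₁ x₂ y₂ : ℝ) (ha : x₁ * y₂ - x₂ * y₁ ≠ 0)
    (D : Matrix (Fin 3) (Fin 3) ℝ) :
    ∀ i j : Fin 4,
      (∫ η in (-1 : ℝ)..1,
          ((B1 x₁ y₁ x₂ y₂ η).transpose * D * B1 x₁ y₁ x₂ y₂ η) i j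
            * detJ x₁ y₁ x₂ y₂ η)
        = ((Matrix.reindex finSumFinEquiv finSumFinEquiv
            (((2 : ℝ) / 3) •
              Matrix.fromBlocks
                ((2 : ℝ) • Q0 x₁ y₁ x₂ y₂ D) (Q0 x₁ y₁ x₂ y₂ D)
                (Q0 x₁ y₁ x₂ y₂ D) ((2 : ℝ) • Q0 x₁ y₁ x₂ y₂ D))
            : Matrix (Fin 4) (Fin 4) ℝ)) i j := by
  intro i j
  simp_rw [integrand_eq x₁ y₁ x₂ y₂ ha D]
  exact integral_Nmat _ i j

end SBFEMStmt10
end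

section
/- For a 2-node line element with nodal coordinates (x₁,y₁), (x₂,y₂) satisfying a = x₁y₂ − x₂y₁ ≠ 0, with shape functions N₁(η) = (1−η)/2, N₂(η) = (1+η)/2, boundary geometry x_b(η) = N₁x₁ + N₂x₂, y_b(η) = N₁y₁ + N₂y₂, Jacobian det J(η) = x_b y_b' − y_b x_b', matrices B₁(η) = b₁(η)·[N₁(η)I₂, N₂(η)I₂] with b₁(η) = (1/det J)·[[y_b', 0], [0, −x_b'], [−x_b', y_b']], and B₂(η) = b₂(η)·[N₁'(η)I₂, N₂'(η)I₂] with b₂(η) = (1/det J)·[[−y_b(η), 0], [0, x_b(η)], [x_b(η), −y_b(η)]], and D a 3×3 real matrix, the coefficient matrix E₁ = ∫_{−1}^{1} B₂(η)ᵀ D B₁(η) det J(η) dη equals the 4×4 block matrix (1/3)·[[−Q⁰, Q⁰], [Q⁰, −Q⁰]] + 2·[[−Q¹, −Q¹], [Q¹, Q¹]], where Q⁰ = (1/(4a))·C₁ᵀDC₁, Q¹ = −(1/(4a))·C₂ᵀDC₁, C₁ = [[y₂−y₁, 0], [0, −(x₂−x₁)], [−(x₂−x₁), y₂−y₁]], and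 C₂ = (1/2)·[[y₂+y₁, 0], [0, −(x₂+x₁)], [−(x₂+x₁), y₂+y₁]]. -/
namespace SBFEMStmt11

/-- linear shape function `N₁(η) = (1−η)/2` -/
noncomputable def N1 (η : ℝ) : ℝ := (1 - η) / 2
/-- linear shape function `N₂(η) = (1+η)/2` -/
noncomputable def N2 (η : ℝ) : ℝ := (1 + η) / 2
/-- boundary geometry `x_b(η) = N₁(η)x₁ + N₂(η)x₂` -/
noncomputable def xb (x₁ x₂ η : ℝ) : ℝ := N1 η * x₁ + N2 η * x₂
/-- boundary geometry `y_b(η) = N₁(η)y₁ + N₂(η)y₂` -/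
noncomputable def yb (y₁ y₂ η : ℝ) : ℝ := N1 η * y₁ + N2 η * y₂
/-- Jacobian determinant `det J(η) = x_b y_b' − y_b x_b'` -/
noncomputable def detJ (x₁ y₁ x₂ y₂ η : ℝ) : ℝ :=
  xb x₁ x₂ η * deriv (yb y₁ y₂) η - yb y₁ y₂ η * deriv (xb x₁ x₂) η
/-- `b₁(η) = (1/det J)·[[y_b', 0], [0, −x_b'], [−x_b', y_b']]` -/
noncomputable def b1 (x₁ y₁ x₂ y₂ η : ℝ) : Matrix (Fin 3) (Fin 2) ℝ :=
  (1 / detJ x₁ y₁ x₂ y₂ η) •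
    !![deriv (yb y₁ y₂) η, 0;
       0, -(deriv (xb x₁ x₂) η);
       -(deriv (xb x₁ x₂) η), deriv (yb y₁ y₂) η]
/-- `b₂(η) = (1/det J)·[[−y_b, 0], [0, x_b], [x_b, −y_b]]` -/
noncomputable def b2 (x₁ y₁ x₂ y₂ η : ℝ) : Matrix (Fin 3) (Fin 2) ℝ :=
  (1 / detJ x₁ y₁ x₂ y₂ η) •
    !![-(yb y₁ y₂ η), 0;
       0, xb x₁ x₂ η;
       xb x₁ x₂ η, -(yb y₁ y₂ η)]
/-- shape function matrix `[N₁ I₂, N₂ I₂]` -/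
noncomputable def Nmat (η : ℝ) : Matrix (Fin 2) (Fin 4) ℝ :=
  !![N1 η, 0, N2 η, 0;
     0, N1 η, 0, N2 η]
/-- derivative shape function matrix `[N₁' I₂, N₂' I₂]` -/
noncomputable def dNmat (η : ℝ) : Matrix (Fin 2) (Fin 4) ℝ :=
  !![deriv N1 η, 0, deriv N2 η, 0;
     0, deriv N1 η, 0, deriv N2 η]
/-- strain matrix `B₁(η) = b₁(η)·[N₁ I₂, N₂ I₂]` -/
noncomputable def B1 (x₁ y₁ x₂ y₂ η : ℝ) : Matrix (Fin 3) (Fin 4) ℝ :=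
  b1 x₁ y₁ x₂ y₂ η * Nmat η
/-- strain matrix `B₂(η) = b₂(η)·[N₁' I₂, N₂' I₂]` -/
noncomputable def B2 (x₁ y₁ x₂ y₂ η : ℝ) : Matrix (Fin 3) (Fin 4) ℝ :=
  b2 x₁ y₁ x₂ y₂ η * dNmat η
/-- `C₁ = [[y₂−y₁, 0], [0, −(x₂−x₁)], [−(x₂−x₁), y₂−y₁]]` -/
noncomputable def C1 (x₁ y₁ x₂ y₂ : ℝ) : Matrix (Fin 3) (Fin 2) ℝ :=
  !![y₂ - y₁, 0;
     0, -(x₂ - x₁);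
     -(x₂ - x₁), y₂ - y₁]
/-- `C₂ = (1/2)·[[y₂+y₁, 0], [0, −(x₂+x₁)], [−(x₂+x₁), y₂+y₁]]` -/
noncomputable def C2 (x₁ y₁ x₂ y₂ : ℝ) : Matrix (Fin 3) (Fin 2) ℝ :=
  (1 / 2 : ℝ) •
    !![y₂ + y₁, 0;
       0, -(x₂ + x₁);
       -(x₂ + x₁), y₂ + y₁]
/-- `Q⁰ = (1/(4a))·C₁ᵀ D C₁` with `a = x₁y₂ − x₂y₁` -/
noncomputable def Q0 (x₁ y₁ x₂ y₂ : ℝ) (D : Matrix (Fin 3) (Fin 3) ℝ) :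
    Matrix (Fin 2) (Fin 2) ℝ :=
  (1 / (4 * (x₁ * y₂ - x₂ * y₁))) •
    ((C1 x₁ y₁ x₂ y₂).transpose * D * C1 x₁ y₁ x₂ y₂)
/-- `Q¹ = −(1/(4a))·C₂ᵀ D C₁` with `a = x₁y₂ − x₂y₁` -/
noncomputable def Q1 (x₁ y₁ x₂ y₂ : ℝ) (D : Matrix (Fin 3) (Fin 3) ℝ) :
    Matrix (Fin 2) (Fin 2) ℝ :=
  (-(1 / (4 * (x₁ * y₂ - x₂ * y₁)))) •
    ((C2 x₁ y₁ x₂ y₂).transpose * D * C1 x₁ y₁ x₂ y₂)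

lemma hasDerivAt_N1 (η : ℝ) : HasDerivAt N1 (-1 / 2) η :=
  ((hasDerivAt_id η).const_sub 1).div_const 2

lemma hasDerivAt_N2 (η : ℝ) : HasDerivAt N2 (1 / 2) η :=
  ((hasDerivAt_id η).const_add 1).div_const 2

lemma deriv_xb (x₁ x₂ η : ℝ) : deriv (xb x₁ x₂) η = (x₂ - x₁) / 2 := by
  have h := ((hasDerivAt_N1 η).mul_const x₁).add ((hasDerivAt_N2 η).mul_const x₂)
  refine (show HasDerivAt (xb x₁ x₂) _ η from h).deriv.trans ?_
  ring

lemma deriv_yb (y₁ y₂ η : ℝ) : deriv (yb y₁ y₂) η = (y₂ - y₁) / 2 :=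
  deriv_xb y₁ y₂ η

lemma detJ_eq (x₁ y₁ x₂ y₂ η : ℝ) : detJ x₁ y₁ x₂ y₂ η = (x₁ * y₂ - x₂ * y₁) / 2 := by
  simp only [detJ, deriv_xb, deriv_yb, xb, yb, N1, N2]
  ring

lemma b1_eq (x₁ y₁ x₂ y₂ η : ℝ) :
    b1 x₁ y₁ x₂ y₂ η = (1 / (x₁ * y₂ - x₂ * y₁)) • C1 x₁ y₁ x₂ y₂ := by
  ext i j
  fin_cases i <;> fin_cases j <;> simp [b1, C1, detJ_eq, deriv_xb, deriv_yb] <;> ring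

lemma b2_eq (x₁ y₁ x₂ y₂ η : ℝ) :
    b2 x₁ y₁ x₂ y₂ η =
      (-(2 / (x₁ * y₂ - x₂ * y₁))) • (C2 x₁ y₁ x₂ y₂ + (η / 2) • C1 x₁ y₁ x₂ y₂) := by
  ext i j
  fin_cases i <;> fin_cases j <;> simp [b2, C1, C2, detJ_eq, xb, yb, N1, N2] <;> ring

lemma Nmat_submatrix (η : ℝ) :
    (Nmat η).submatrix id (finSumFinEquiv (m := 2) (n := 2)) =
      Matrix.fromCols (N1 η • 1) (N2 η • 1) := by
  ext i (j | j) <;> fin_cases i <;> fin_cases j <;> simp [Nmat, finSumFinEquiv]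

lemma dNmat_submatrix (η : ℝ) :
    (dNmat η).submatrix id (finSumFinEquiv (m := 2) (n := 2)) =
      Matrix.fromCols ((-1 / 2 : ℝ) • 1) ((1 / 2 : ℝ) • 1) := by
  ext i (j | j) <;> fin_cases i <;> fin_cases j <;>
    simp [dNmat, finSumFinEquiv, (hasDerivAt_N1 η).deriv, (hasDerivAt_N2 η).deriv]

lemma B1_submatrix (x₁ y₁ x₂ y₂ η : ℝ) :
    (B1 x₁ y₁ x₂ y₂ η).submatrix id (finSumFinEquiv (m := 2) (n := 2)) =
      Matrix.fromCols (N1 η • b1 x₁ y₁ x₂ y₂ η) (N2 η • b1 x₁ y₁ x₂ y₂ η) := by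
  rw [B1, Matrix.submatrix_mul _ _ id id _ Function.bijective_id, Nmat_submatrix,
    Matrix.submatrix_id_id, Matrix.mul_fromCols, Matrix.mul_smul, Matrix.mul_smul, Matrix.mul_one]

lemma B2_submatrix (x₁ y₁ x₂ y₂ η : ℝ) :
    (B2 x₁ y₁ x₂ y₂ η).submatrix id (finSumFinEquiv (m := 2) (n := 2)) =
      Matrix.fromCols ((-1 / 2 : ℝ) • b2 x₁ y₁ x₂ y₂ η) ((1 / 2 : ℝ) • b2 x₁ y₁ x₂ y₂ η) := by
  rw [B2, Matrix.submatrix_mul _ _ id id _ Function.bijective_id, dNmat_submatrix,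
    Matrix.submatrix_id_id, Matrix.mul_fromCols, Matrix.mul_smul, Matrix.mul_smul, Matrix.mul_one]

lemma integrand_submatrix (x₁ y₁ x₂ y₂ : ℝ) (D : Matrix (Fin 3) (Fin 3) ℝ) (η : ℝ) :
    ((B2 x₁ y₁ x₂ y₂ η).transpose * D * B1 x₁ y₁ x₂ y₂ η).submatrix
        (finSumFinEquiv (m := 2) (n := 2)) (finSumFinEquiv (m := 2) (n := 2)) =
      let P := (b2 x₁ y₁ x₂ y₂ η).transpose * D * b1 x₁ y₁ x₂ y₂ η
      Matrix.fromBlocks ((-(N1 η) / 2) • P) ((-(N2 η) / 2) • P)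
        ((N1 η / 2) • P) ((N2 η / 2) • P) := by
  rw [Matrix.submatrix_mul _ _ _ id _ Function.bijective_id,
    Matrix.submatrix_mul _ _ _ id _ Function.bijective_id, ← Matrix.transpose_submatrix,
    B1_submatrix, B2_submatrix, Matrix.submatrix_id_id, Matrix.transpose_fromCols,
    Matrix.fromRows_mul, Matrix.fromRows_mul_fromCols]
  simp only [Matrix.transpose_smul, Matrix.smul_mul, Matrix.mul_smul, smul_smul]
  congr 2 <;> ring

lemma b2_mul_b1_mul_detJ {x₁ y₁ x₂ y₂ : ℝ} (ha : x₁ * y₂ - x₂ * y₁ ≠ 0)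
    (D : Matrix (Fin 3) (Fin 3) ℝ) (η : ℝ) (k l : Fin 2) :
    ((b2 x₁ y₁ x₂ y₂ η).transpose * D * b1 x₁ y₁ x₂ y₂ η) k l * detJ x₁ y₁ x₂ y₂ η =
      4 * Q1 x₁ y₁ x₂ y₂ D k l - 2 * η * Q0 x₁ y₁ x₂ y₂ D k l := by
  rw [b1_eq, b2_eq, detJ_eq, Q0, Q1]
  simp only [Matrix.transpose_smul, Matrix.transpose_add, Matrix.smul_mul, Matrix.mul_smul,
    Matrix.add_mul, Matrix.smul_apply, Matrix.add_apply, smul_eq_mul]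
  field_simp
  ring

lemma integral_N1_mul (p q : ℝ) :
    ∫ η in (-1 : ℝ)..1, N1 η * (4 * p - 2 * η * q) = 4 * p + 2 / 3 * q := by
  have h (η : ℝ) : N1 η * (4 * p - 2 * η * q) = 2 * p + η * (-2 * p - q) + q * η ^ 2 := by
    rw [N1]; ring
  simp_rw [h]
  rw [intervalIntegral.integral_add (Continuous.intervalIntegrable (by fun_prop) _ _)
      (Continuous.intervalIntegrable (by fun_prop) _ _),
    intervalIntegral.integral_add (Continuous.intervalIntegrable (by fun_prop) _ _)
      (Continuous.intervalIntegrable (by fun_prop) _ _)]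
  simp only [intervalIntegral.integral_const, intervalIntegral.integral_const_mul,
    intervalIntegral.integral_mul_const, integral_id, integral_pow, smul_eq_mul]
  norm_num
  ring

lemma integral_N2_mul (p q : ℝ) :
    ∫ η in (-1 : ℝ)..1, N2 η * (4 * p - 2 * η * q) = 4 * p - 2 / 3 * q := by
  have h := intervalIntegral.integral_comp_neg (a := -1) (b := 1)
    (fun η => N1 η * (4 * p - 2 * η * -q))
  rw [neg_neg, integral_N1_mul] at h
  rw [sub_eq_add_neg, ← mul_neg, ← h]
  refine intervalIntegral.integral_congr fun η _ => ?_
  simp only [N1, N2]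
  ring

/-- the SBFEM coefficient matrix
`E₁ = ∫_{−1}^{1} B₂ᵀ D B₁ det J dη` for a 2-node line element equals
`(1/3)·[[−Q⁰, Q⁰], [Q⁰, −Q⁰]] + 2·[[−Q¹, −Q¹], [Q¹, Q¹]]`. -/
theorem sbfem_E1_closed_form (x₁ y₁ x₂ y₂ : ℝ) (ha : x₁ * y₂ - x₂ * y₁ ≠ 0)
    (D : Matrix (Fin 3) (Fin 3) ℝ) :
    ∀ i j : Fin 4,
      (∫ η in (-1 : ℝ)..1,
          ((B2 x₁ y₁ x₂ y₂ η).transpose * D * B1 x₁ y₁ x₂ y₂ η) i j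
            * detJ x₁ y₁ x₂ y₂ η)
        = ((Matrix.reindex finSumFinEquiv finSumFinEquiv
            (((1 : ℝ) / 3) •
                Matrix.fromBlocks
                  (-Q0 x₁ y₁ x₂ y₂ D) (Q0 x₁ y₁ x₂ y₂ D)
                  (Q0 x₁ y₁ x₂ y₂ D) (-Q0 x₁ y₁ x₂ y₂ D)
              + (2 : ℝ) •
                Matrix.fromBlocks
                  (-Q1 x₁ y₁ x₂ y₂ D) (-Q1 x₁ y₁ x₂ y₂ D)
                  (Q1 x₁ y₁ x₂ y₂ D) (Q1 x₁ y₁ x₂ y₂ D))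
            : Matrix (Fin 4) (Fin 4) ℝ)) i j := by
  intro i j
  obtain ⟨i, rfl⟩ := (finSumFinEquiv (m := 2) (n := 2)).surjective i
  obtain ⟨j, rfl⟩ := (finSumFinEquiv (m := 2) (n := 2)).surjective j
  have h (η : ℝ) := congrFun₂ (integrand_submatrix x₁ y₁ x₂ y₂ D η) i j
  simp only [Matrix.submatrix_apply] at h
  simp_rw [h]
  rcases i with i | i <;> rcases j with j | j <;>
    simp only [Matrix.fromBlocks_apply₁₁, Matrix.fromBlocks_apply₁₂, Matrix.fromBlocks_apply₂₁,
      Matrix.fromBlocks_apply₂₂, Matrix.smul_apply, Matrix.add_apply, Matrix.neg_apply,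
      Matrix.reindex_apply, Matrix.submatrix_apply, Equiv.symm_apply_apply, smul_eq_mul,
      mul_assoc _ _ (detJ _ _ _ _ _), b2_mul_b1_mul_detJ ha, neg_div, div_mul_eq_mul_div, neg_mul,
      intervalIntegral.integral_neg, intervalIntegral.integral_div, integral_N1_mul,
      integral_N2_mul] <;>
    ring

end SBFEMStmt11
end

section
/- For a 2-node line element with nodal coordinates (x₁,y₁), (x₂,y₂) satisfying a = x₁y₂ − x₂y₁ ≠ 0, with shape functions N₁(η) = (1−η)/2, N₂(η) = (1+η)/2, boundary geometry x_b(η) = N₁x₁ + N₂x₂, y_b(η) = N₁y₁ + N₂y₂, Jacobian det J(η) = x_b y_b' − y_b x_b', matrix B₂(η) = b₂(η)·[N₁'(η)I₂, N₂'(η)I₂] with b₂(η) = (1/det J)·[[−y_b(η), 0], [0, x_b(η)], [x_b(η), −y_b(η)]], and D a 3×3 real matrix, the coefficient matrix E₂ = ∫_{−1}^{1} B₂(η)ᵀ D B₂(η) det J(η) dη equals the 4×4 block matrix (1/3)·[[Q⁰, −Q⁰], [−Q⁰, Q⁰]] + 4·[[Q², −Q²], [−Q², Q²]], where Q⁰ =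 (1/(4a))·C₁ᵀDC₁, Q² = (1/(4a))·C₂ᵀDC₂, C₁ = [[y₂−y₁, 0], [0, −(x₂−x₁)], [−(x₂−x₁), y₂−y₁]], and C₂ = (1/2)·[[y₂+y₁, 0], [0, −(x₂+x₁)], [−(x₂+x₁), y₂+y₁]]. -/
namespace SBFEMStmt12

/-- linear shape function `N₁(η) = (1−η)/2` -/
noncomputable def N1 (η : ℝ) : ℝ := (1 - η) / 2
/-- linear shape function `N₂(η) = (1+η)/2` -/
noncomputable def N2 (η : ℝ) : ℝ := (1 + η) / 2
/-- boundary geometry `x_b(η) = N₁(η)x₁ + N₂(η)x₂` -/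
noncomputable def xb (x₁ x₂ η : ℝ) : ℝ := N1 η * x₁ + N2 η * x₂
/-- boundary geometry `y_b(η) = N₁(η)y₁ + N₂(η)y₂` -/
noncomputable def yb (y₁ y₂ η : ℝ) : ℝ := N1 η * y₁ + N2 η * y₂
/-- Jacobian determinant `det J(η) = x_b y_b' − y_b x_b'` -/
noncomputable def detJ (x₁ y₁ x₂ y₂ η : ℝ) : ℝ :=
  xb x₁ x₂ η * deriv (yb y₁ y₂) η - yb y₁ y₂ η * deriv (xb x₁ x₂) η
/-- `b₂(η) = (1/det J)·[[−y_b, 0], [0, x_b], [x_b, −y_b]]` -/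
noncomputable def b2 (x₁ y₁ x₂ y₂ η : ℝ) : Matrix (Fin 3) (Fin 2) ℝ :=
  (1 / detJ x₁ y₁ x₂ y₂ η) •
    !![-(yb y₁ y₂ η), 0;
       0, xb x₁ x₂ η;
       xb x₁ x₂ η, -(yb y₁ y₂ η)]
/-- derivative shape function matrix `[N₁' I₂, N₂' I₂]` -/
noncomputable def dNmat (η : ℝ) : Matrix (Fin 2) (Fin 4) ℝ :=
  !![deriv N1 η, 0, deriv N2 η, 0;
     0, deriv N1 η, 0, deriv N2 η]
/-- strain matrix `B₂(η) = b₂(η)·[N₁' I₂, N₂' I₂]` -/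
noncomputable def B2 (x₁ y₁ x₂ y₂ η : ℝ) : Matrix (Fin 3) (Fin 4) ℝ :=
  b2 x₁ y₁ x₂ y₂ η * dNmat η
/-- `C₁ = [[y₂−y₁, 0], [0, −(x₂−x₁)], [−(x₂−x₁), y₂−y₁]]` -/
noncomputable def C1 (x₁ y₁ x₂ y₂ : ℝ) : Matrix (Fin 3) (Fin 2) ℝ :=
  !![y₂ - y₁, 0;
     0, -(x₂ - x₁);
     -(x₂ - x₁), y₂ - y₁]
/-- `C₂ = (1/2)·[[y₂+y₁, 0], [0, −(x₂+x₁)], [−(x₂+x₁), y₂+y₁]]` -/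
noncomputable def C2 (x₁ y₁ x₂ y₂ : ℝ) : Matrix (Fin 3) (Fin 2) ℝ :=
  (1 / 2 : ℝ) •
    !![y₂ + y₁, 0;
       0, -(x₂ + x₁);
       -(x₂ + x₁), y₂ + y₁]
/-- `Q⁰ = (1/(4a))·C₁ᵀ D C₁` with `a = x₁y₂ − x₂y₁` -/
noncomputable def Q0 (x₁ y₁ x₂ y₂ : ℝ) (D : Matrix (Fin 3) (Fin 3) ℝ) :
    Matrix (Fin 2) (Fin 2) ℝ :=
  (1 / (4 * (x₁ * y₂ - x₂ * y₁))) •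
    ((C1 x₁ y₁ x₂ y₂).transpose * D * C1 x₁ y₁ x₂ y₂)
/-- `Q² = (1/(4a))·C₂ᵀ D C₂` with `a = x₁y₂ − x₂y₁` -/
noncomputable def Q2 (x₁ y₁ x₂ y₂ : ℝ) (D : Matrix (Fin 3) (Fin 3) ℝ) :
    Matrix (Fin 2) (Fin 2) ℝ :=
  (1 / (4 * (x₁ * y₂ - x₂ * y₁))) •
    ((C2 x₁ y₁ x₂ y₂).transpose * D * C2 x₁ y₁ x₂ y₂)

theorem hasDerivAt_N1 (η : ℝ) : HasDerivAt N1 (-1 / 2) η :=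
  ((hasDerivAt_id η).const_sub 1).div_const 2

theorem hasDerivAt_N2 (η : ℝ) : HasDerivAt N2 (1 / 2) η :=
  ((hasDerivAt_id η).const_add 1).div_const 2

theorem deriv_xb (x₁ x₂ η : ℝ) : deriv (xb x₁ x₂) η = (x₂ - x₁) / 2 := by
  have h : HasDerivAt (xb x₁ x₂) (-1 / 2 * x₁ + 1 / 2 * x₂) η :=
    ((hasDerivAt_N1 η).mul_const x₁).add ((hasDerivAt_N2 η).mul_const x₂)
  rw [h.deriv]
  ring

theorem deriv_yb (y₁ y₂ η : ℝ) : deriv (yb y₁ y₂) η = (y₂ - y₁) / 2 :=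
  deriv_xb y₁ y₂ η

theorem detJ_eq (x₁ y₁ x₂ y₂ η : ℝ) :
    detJ x₁ y₁ x₂ y₂ η = (x₁ * y₂ - x₂ * y₁) / 2 := by
  simp only [detJ, deriv_xb, deriv_yb, xb, yb, N1, N2]
  ring

/-- The difference matrix `[I, -I]`, with columns indexed by `Fin 4`. -/
def blockDiff : Matrix (Fin 2) (Fin 4) ℝ :=
  !![1, 0, -1, 0;
     0, 1, 0, -1]

theorem dNmat_eq (η : ℝ) : dNmat η = (-1 / 2 : ℝ) • blockDiff := by
  ext i j
  fin_cases i <;> fin_cases j <;>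
    norm_num [dNmat, blockDiff, (hasDerivAt_N1 η).deriv, (hasDerivAt_N2 η).deriv]

theorem b2_eq (x₁ y₁ x₂ y₂ η : ℝ) :
    b2 x₁ y₁ x₂ y₂ η =
      (-2 / (x₁ * y₂ - x₂ * y₁)) • (C2 x₁ y₁ x₂ y₂ + (η / 2) • C1 x₁ y₁ x₂ y₂) := by
  ext i j
  fin_cases i <;> fin_cases j <;>
    simp [b2, detJ_eq, C1, C2, xb, yb, N1, N2] <;> ring

theorem B2_eq (x₁ y₁ x₂ y₂ η : ℝ) :
    B2 x₁ y₁ x₂ y₂ η =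
      (1 / (x₁ * y₂ - x₂ * y₁)) •
        ((C2 x₁ y₁ x₂ y₂ + (η / 2) • C1 x₁ y₁ x₂ y₂) * blockDiff) := by
  rw [B2, b2_eq, dNmat_eq, Matrix.smul_mul, Matrix.mul_smul, smul_smul]
  congr 1
  ring

theorem blockDiff_transpose_mul_mul (Q : Matrix (Fin 2) (Fin 2) ℝ) :
    blockDiff.transpose * Q * blockDiff =
      Matrix.reindex finSumFinEquiv finSumFinEquiv (Matrix.fromBlocks Q (-Q) (-Q) Q) := by
  rw [← Equiv.symm_apply_eq]
  ext (i | i) (j | j) <;> fin_cases i <;> fin_cases j <;>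
    simp [blockDiff, Matrix.mul_apply, Fin.sum_univ_two, finSumFinEquiv]

theorem integral_quadratic (p q r : ℝ) :
    ∫ η in (-1 : ℝ)..1, (p + q * η + r * η ^ 2) = 2 * p + 2 / 3 * r := by
  rw [intervalIntegral.integral_add (Continuous.intervalIntegrable (by fun_prop) _ _)
      (Continuous.intervalIntegrable (by fun_prop) _ _),
    intervalIntegral.integral_add (Continuous.intervalIntegrable (by fun_prop) _ _)
      (Continuous.intervalIntegrable (by fun_prop) _ _)]
  have h : ∫ η in (-1 : ℝ)..1, q * η = 0 := by
    rw [intervalIntegral.integral_const_mul, integral_id]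
    norm_num
  rw [h, intervalIntegral.integral_const, intervalIntegral.integral_const_mul, integral_pow,
    smul_eq_mul]
  norm_num
  ring

theorem transpose_add_smul_mul_mul {m n : Type*} [Fintype m] (A B : Matrix m n ℝ)
    (D : Matrix m m ℝ) (t : ℝ) :
    (A + t • B).transpose * D * (A + t • B) =
      A.transpose * D * A + t • (A.transpose * D * B + B.transpose * D * A) +
        t ^ 2 • (B.transpose * D * B) := by
  simp only [Matrix.transpose_add, Matrix.transpose_smul, Matrix.add_mul, Matrix.mul_add,
    Matrix.smul_mul, Matrix.mul_smul, smul_add, smul_smul, pow_two]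
  abel

/-- the SBFEM coefficient matrix
`E₂ = ∫_{−1}^{1} B₂ᵀ D B₂ det J dη` for a 2-node line element equals
`(1/3)·[[Q⁰, −Q⁰], [−Q⁰, Q⁰]] + 4·[[Q², −Q²], [−Q², Q²]]`. -/
theorem sbfem_E2_closed_form (x₁ y₁ x₂ y₂ : ℝ) (ha : x₁ * y₂ - x₂ * y₁ ≠ 0)
    (D : Matrix (Fin 3) (Fin 3) ℝ) :
    ∀ i j : Fin 4,
      (∫ η in (-1 : ℝ)..1,
          ((B2 x₁ y₁ x₂ y₂ η).transpose * D * B2 x₁ y₁ x₂ y₂ η) i j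
            * detJ x₁ y₁ x₂ y₂ η)
        = ((Matrix.reindex finSumFinEquiv finSumFinEquiv
            (((1 : ℝ) / 3) •
                Matrix.fromBlocks
                  (Q0 x₁ y₁ x₂ y₂ D) (-Q0 x₁ y₁ x₂ y₂ D)
                  (-Q0 x₁ y₁ x₂ y₂ D) (Q0 x₁ y₁ x₂ y₂ D)
              + (4 : ℝ) •
                Matrix.fromBlocks
                  (Q2 x₁ y₁ x₂ y₂ D) (-Q2 x₁ y₁ x₂ y₂ D)
                  (-Q2 x₁ y₁ x₂ y₂ D) (Q2 x₁ y₁ x₂ y₂ D))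
            : Matrix (Fin 4) (Fin 4) ℝ)) i j := by
  intro i j
  set a := x₁ * y₂ - x₂ * y₁ with ha_def
  set A := C2 x₁ y₁ x₂ y₂
  set B := C1 x₁ y₁ x₂ y₂
  have hint (η : ℝ) :
      ((B2 x₁ y₁ x₂ y₂ η).transpose * D * B2 x₁ y₁ x₂ y₂ η) i j * detJ x₁ y₁ x₂ y₂ η =
        1 / (2 * a) * (blockDiff.transpose * (A.transpose * D * A) * blockDiff) i j +
        1 / (4 * a) * (blockDiff.transpose *
          (A.transpose * D * B + B.transpose * D * A) * blockDiff) i j * η +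
        1 / (8 * a) * (blockDiff.transpose * (B.transpose * D * B) * blockDiff) i j * η ^ 2 := by
    have hB2 : (B2 x₁ y₁ x₂ y₂ η).transpose * D * B2 x₁ y₁ x₂ y₂ η =
        (1 / a ^ 2) • (blockDiff.transpose *
          ((A + (η / 2) • B).transpose * D * (A + (η / 2) • B)) * blockDiff) := by
      rw [B2_eq, Matrix.transpose_smul, Matrix.transpose_mul]
      simp only [Matrix.smul_mul, Matrix.mul_smul, smul_smul, Matrix.mul_assoc]
      congr 1
      rw [← ha_def]
      field_simp
    rw [hB2, detJ_eq, ← ha_def, transpose_add_smul_mul_mul]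
    simp only [Matrix.mul_add (blockDiff.transpose), Matrix.add_mul _ _ blockDiff,
      Matrix.mul_smul, Matrix.smul_mul, Matrix.add_apply, Matrix.smul_apply, smul_eq_mul]
    field_simp
    ring
  simp only [hint]
  have hQ0 : Q0 x₁ y₁ x₂ y₂ D = (1 / (4 * a)) • (B.transpose * D * B) := rfl
  have hQ2 : Q2 x₁ y₁ x₂ y₂ D = (1 / (4 * a)) • (A.transpose * D * A) := rfl
  have hsplit (U V : Matrix (Fin 2 ⊕ Fin 2) (Fin 2 ⊕ Fin 2) ℝ) :
      Matrix.reindex finSumFinEquiv finSumFinEquiv (((1 : ℝ) / 3) • U + (4 : ℝ) • V) =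
        ((1 : ℝ) / 3) • Matrix.reindex finSumFinEquiv finSumFinEquiv U +
          (4 : ℝ) • Matrix.reindex finSumFinEquiv finSumFinEquiv V := rfl
  rw [integral_quadratic, hsplit, ← blockDiff_transpose_mul_mul, ← blockDiff_transpose_mul_mul,
    hQ0, hQ2]
  simp only [Matrix.mul_smul, Matrix.smul_mul, Matrix.add_apply, Matrix.smul_apply, smul_eq_mul]
  field_simp
  ring

end SBFEMStmt12
end
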